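/- Let λ ∈ ℂ with λ ≠ 0. Set 𝒦_λ := ⊕_{r=1}^{N} (⊕_{j=1}^{m_r} K_{α_r}(λ)), a complex skew-symmetric matrix of size 2n×2n where n := α_1 m_1 + … + α_N m_N. Then there exists an invertible matrix Ψ ∈ GL_{2n}(ℂ) such that the map Q ↦ Ψ Q Ψ^{-1} is a bijection from the isotropy group Σ_{𝒦_λ} := {Q ∈ M_{2n}(ℂ) : QᵀQ = I and Qᵀ 𝒦_λ Q = 𝒦_λ} onto the set {𝒳 ⊕ (𝒳^{-1})ᵀ : 𝒳 ∈ 𝕋^{α,μ}} (direct sum meaning the 2n×2n block diagonal matrix with diagonal blocks 𝒳 and (𝒳^{-1})ᵀ). In particular, Σ_{𝒦_λ} is isomorphic as a group to 𝕋^{α,μ}. -/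

import Mathlib

open Matrix Complex

noncomputable section

/-- The `m × m` matrix `M_m` with `1/2` on the first superdiagonal and `-1/2` on the
first subdiagonal. -/
def Mmat (m : ℕ) : Matrix (Fin m) (Fin m) ℂ :=
  Matrix.of fun j k =>
    if (k : ℕ) = (j : ℕ) + 1 then (1 : ℂ) / 2
    else if (j : ℕ) = (k : ℕ) + 1 then -(1 / 2) else 0

/-- The `m × m` matrix `N_m(λ)`: `i·λ` on the antidiagonal (`j+k = m+1`, 1-based), and `i/2`
just off it (`j+k = m` or `j+k = m+2`, 1-based). -/
def Nmat (m : ℕ) (lam : ℂ) : Matrix (Fin m) (Fin m) ℂ :=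
  Matrix.of fun j k =>
    if (j : ℕ) + (k : ℕ) + 2 = m + 1 then Complex.I * lam
    else if (j : ℕ) + (k : ℕ) + 2 = m ∨ (j : ℕ) + (k : ℕ) + 2 = m + 2 then Complex.I / 2
    else 0

/-- The `2m × 2m` skew-symmetric matrix `K_m(λ) = [[M_m, N_m(λ)], [-N_m(λ), -M_m]]`. -/
def Kmat (m : ℕ) (lam : ℂ) : Matrix (Fin m ⊕ Fin m) (Fin m ⊕ Fin m) ℂ :=
  Matrix.fromBlocks (Mmat m) (Nmat m lam) (-Nmat m lam) (-Mmat m)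

/-- `𝒦_λ = ⊕_{r=1}^{N} (⊕_{j=1}^{m_r} K_{α_r}(λ))`. -/
def KK (N : ℕ) (α m : Fin N → ℕ) (lam : ℂ) :
    Matrix ((r : Fin N) × (_j : Fin (m r)) × (Fin (α r) ⊕ Fin (α r)))
      ((r : Fin N) × (_j : Fin (m r)) × (Fin (α r) ⊕ Fin (α r))) ℂ :=
  Matrix.blockDiagonal' fun r =>
    Matrix.blockDiagonal' fun _ : Fin (m r) => Kmat (α r) lam

/-- The block-Toeplitz pattern: each block `𝒳_{rs}` (an `α_r × α_s` array of `m_r × m_s`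
sub-blocks) is rectangular upper triangular block Toeplitz. -/
def BlockToeplitz (N : ℕ) (α m : Fin N → ℕ)
    (X : Matrix ((r : Fin N) × (Fin (α r) × Fin (m r)))
      ((r : Fin N) × (Fin (α r) × Fin (m r))) ℂ) : Prop :=
  (∀ (r s : Fin N) (i i' : Fin (α r)) (j j' : Fin (α s)) (p : Fin (m r)) (q : Fin (m s)),
      (i' : ℕ) = (i : ℕ) + 1 → (j' : ℕ) = (j : ℕ) + 1 →
      X ⟨r, i', p⟩ ⟨s, j', q⟩ = X ⟨r, i, p⟩ ⟨s, j, q⟩) ∧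
  (∀ (r s : Fin N) (i : Fin (α r)) (j : Fin (α s)) (p : Fin (m r)) (q : Fin (m s)),
      (i : ℕ) ≠ 0 → (j : ℕ) = 0 → X ⟨r, i, p⟩ ⟨s, j, q⟩ = 0) ∧
  (∀ (r s : Fin N) (i : Fin (α r)) (j : Fin (α s)) (p : Fin (m r)) (q : Fin (m s)),
      (i : ℕ) + 1 = α r → (j : ℕ) + 1 < α s → X ⟨r, i, p⟩ ⟨s, j, q⟩ = 0)

section Aux

variable {ι : Type*} [Fintype ι] [DecidableEq ι]

lemma sylv (c : ℂ) (hc : c ≠ 0) (J₁ J₂ B : Matrix ι ι ℂ) (h₁ : IsNilpotent J₁)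
    (h₂ : IsNilpotent J₂) (h : (c • (1 : Matrix ι ι ℂ) + J₁) * B = -(B * (c • (1 : Matrix ι ι ℂ) + J₂))) :
    B = 0 := by
  have h' : ((2 * c) • (1 : Matrix ι ι ℂ) + J₁) * B = B * (-J₂) := by
    simp only [add_mul, mul_add, smul_mul_assoc, mul_smul_comm, one_mul, mul_one, mul_neg] at h ⊢
    have h2 : (2 * c) • B + J₁ * B = c • B + (c • B + J₁ * B) := by module
    rw [h2, h]
    abel
  have hk : ∀ k : ℕ, ((2 * c) • (1 : Matrix ι ι ℂ) + J₁) ^ k * B = B * (-J₂) ^ k := by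
    intro k
    induction k with
    | zero => simp
    | succ k ih => rw [pow_succ, mul_assoc, h', ← mul_assoc, ih, mul_assoc, ← pow_succ]
  obtain ⟨k, hk2⟩ := h₂.neg
  have hu : IsUnit ((2 * c) • (1 : Matrix ι ι ℂ) + J₁) := by
    rw [add_comm]
    apply IsNilpotent.isUnit_add_right_of_commute h₁
    · have : IsUnit (algebraMap ℂ (Matrix ι ι ℂ) (2 * c)) :=
        (IsUnit.mk0 _ (by simpa using hc)).map _
      rwa [Algebra.algebraMap_eq_smul_one] at this
    · exact (Commute.one_right _).smul_right _
  have := hk k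
  rw [hk2, mul_zero] at this
  exact ((hu.pow k).mul_right_eq_zero).1 this

lemma congr_iff (P Ψ T B : Matrix ι ι ℂ) (h : P * Ψ = 1) :
    Tᵀ * B * T = B ↔ (Ψ * T * P)ᵀ * (Pᵀ * B * P) * (Ψ * T * P) = Pᵀ * B * P := by
  have h' : Ψ * P = 1 := mul_eq_one_comm.1 h
  have ht : Ψᵀ * Pᵀ = 1 := by rw [← transpose_mul, h, transpose_one]
  have ht' : Pᵀ * Ψᵀ = 1 := mul_eq_one_comm.1 ht
  have e1 : (Ψ * T * P)ᵀ * (Pᵀ * B * P) * (Ψ * T * P) = Pᵀ * (Tᵀ * B * T) * P := by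
    calc _ = Pᵀ * Tᵀ * (Ψᵀ * Pᵀ) * B * (P * Ψ) * T * P := by
          simp only [transpose_mul, mul_assoc]
      _ = _ := by rw [h, ht]; simp only [mul_one, mul_assoc]
  rw [e1]
  constructor
  · intro H; rw [H]
  · intro H
    have := congrArg (fun Z => Ψᵀ * Z * Ψ) H
    have e2 : ∀ Z, Ψᵀ * (Pᵀ * Z * P) * Ψ = Z := by
      intro Z
      calc _ = (Ψᵀ * Pᵀ) * Z * (P * Ψ) := by simp only [mul_assoc]
        _ = _ := by rw [h, ht]; simp
    simpa only [e2] using this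

def Fm (ι : Type*) [DecidableEq ι] : Matrix (ι ⊕ ι) (ι ⊕ ι) ℂ := fromBlocks 0 1 1 0

lemma Y_iff (c : ℂ) (hc : c ≠ 0) (J : Matrix ι ι ℂ) (hJ : IsNilpotent J)
    (Y : Matrix (ι ⊕ ι) (ι ⊕ ι) ℂ) :
    (Yᵀ * Fm ι * Y = Fm ι ∧
      Yᵀ * fromBlocks 0 (-(c • 1 + Jᵀ)) (c • 1 + J) 0 * Y
        = fromBlocks 0 (-(c • 1 + Jᵀ)) (c • 1 + J) 0) ↔
    ∃ X : Matrix ι ι ℂ, (IsUnit X ∧ X * J = J * X) ∧ Y = fromBlocks X 0 0 (X⁻¹)ᵀ := by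
  have hG : fromBlocks 0 (-(c • 1 + Jᵀ)) (c • 1 + J) 0
      = Fm ι * fromBlocks (c • 1 + J) 0 0 (-(c • 1 + Jᵀ)) := by
    simp [Fm, fromBlocks_multiply]
  have hJt : IsNilpotent Jᵀ := by
    obtain ⟨k, hk⟩ := hJ
    exact ⟨k, by rw [← transpose_pow, hk, transpose_zero]⟩
  constructor
  · rintro ⟨h1, h2⟩
    have hFF : Fm ι * Fm ι = 1 := by simp [Fm, fromBlocks_multiply]
    rw [hG] at h2
    set D := fromBlocks (c • 1 + J) 0 0 (-(c • 1 + Jᵀ)) with hD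
    have hinv : (Fm ι * Yᵀ * Fm ι) * Y = 1 := by
      rw [mul_assoc, mul_assoc, ← mul_assoc Yᵀ, h1, hFF]
    have hinv' := mul_eq_one_comm.1 hinv
    have hcomm : D * Y = Y * D := by
      have h3 : (Fm ι * Yᵀ * Fm ι) * D * Y = D := by
        calc _ = Fm ι * (Yᵀ * (Fm ι * D) * Y) := by simp only [mul_assoc]
          _ = D := by rw [h2, ← mul_assoc, hFF, one_mul]
      calc D * Y = (Y * (Fm ι * Yᵀ * Fm ι)) * (D * Y) := by rw [hinv', one_mul]
        _ = Y * ((Fm ι * Yᵀ * Fm ι) * D * Y) := by simp only [mul_assoc]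
        _ = _ := by rw [h3]
    obtain ⟨A, B, C, E, rfl⟩ : ∃ A B C E, Y = fromBlocks A B C E :=
      ⟨_, _, _, _, (fromBlocks_toBlocks Y).symm⟩
    simp only [hD, fromBlocks_multiply, fromBlocks_inj, zero_mul, mul_zero, add_zero, zero_add]
      at hcomm
    obtain ⟨c1, c2, c3, c4⟩ := hcomm
    have hB : B = 0 := sylv c hc J Jᵀ B hJ hJt (by rw [c2, mul_neg])
    have hC : C = 0 := sylv c hc Jᵀ J C hJt hJ (by rw [← c3, neg_mul, neg_neg])
    subst hB hC
    simp only [Fm, fromBlocks_transpose, fromBlocks_multiply, fromBlocks_inj, zero_mul, mul_zero,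
      add_zero, zero_add, mul_one, transpose_zero] at h1
    obtain ⟨-, h12, h21, -⟩ := h1
    have hX : A * Eᵀ = 1 := mul_eq_one_comm.1 h21
    have hAi : A⁻¹ = Eᵀ := Matrix.inv_eq_right_inv hX
    refine ⟨A, ⟨IsUnit.of_mul_eq_one _ hX, ?_⟩, by rw [hAi, transpose_transpose]⟩
    simp only [add_mul, mul_add, smul_mul_assoc, mul_smul_comm, one_mul, mul_one] at c1
    exact (add_left_cancel c1).symm
  · rintro ⟨X, ⟨hX, hXJ⟩, rfl⟩
    have hd : IsUnit X.det := (Matrix.isUnit_iff_isUnit_det X).1 hX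
    have i1 : X * X⁻¹ = 1 := Matrix.mul_nonsing_inv _ hd
    have i2 : X⁻¹ * X = 1 := Matrix.nonsing_inv_mul _ hd
    have i3 : Xᵀ * (X⁻¹)ᵀ = 1 := by rw [← transpose_mul, i2, transpose_one]
    have i4 : X⁻¹ * J * X = J := by rw [mul_assoc, ← hXJ, ← mul_assoc, i2, one_mul]
    have i5 : Xᵀ * Jᵀ * (X⁻¹)ᵀ = Jᵀ := by
      rw [← transpose_mul, ← transpose_mul, ← mul_assoc, i4]
    constructor
    · simp [Fm, fromBlocks_transpose, fromBlocks_multiply, i2, i3]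
    · simp only [fromBlocks_transpose, fromBlocks_multiply, fromBlocks_inj, zero_mul, mul_zero,
        add_zero, zero_add, transpose_zero, transpose_transpose, true_and, and_true]
      constructor
      · simp only [mul_neg, neg_mul, mul_add, add_mul, smul_mul_assoc, mul_smul_comm, mul_one, i3, i5]
      · simp only [mul_add, add_mul, smul_mul_assoc, mul_smul_comm, mul_one, i2, i4]

def Pm (E : Matrix ι ι ℂ) : Matrix (ι ⊕ ι) (ι ⊕ ι) ℂ :=
  fromBlocks 1 ((1 / 2 : ℂ) • 1) ((-Complex.I) • E) ((Complex.I / 2) • E)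

def Km (c : ℂ) (J E : Matrix ι ι ℂ) : Matrix (ι ⊕ ι) (ι ⊕ ι) ℂ :=
  fromBlocks ((1 / 2 : ℂ) • (J - Jᵀ)) (Complex.I • (E * (c • 1 + (1 / 2 : ℂ) • (J + Jᵀ))))
    (-(Complex.I • (E * (c • 1 + (1 / 2 : ℂ) • (J + Jᵀ))))) (-((1 / 2 : ℂ) • (J - Jᵀ)))

lemma PtP (E : Matrix ι ι ℂ) (hE : Eᵀ = E) (hEE : E * E = 1) :
    (Pm E)ᵀ * Pm E = Fm ι := by
  simp only [Pm, Fm, fromBlocks_transpose, fromBlocks_multiply, fromBlocks_inj, transpose_smul,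
    transpose_one, hE, smul_mul_assoc, mul_smul_comm, hEE, mul_one, one_mul, smul_smul]
  refine ⟨?_, ?_, ?_, ?_⟩ <;> match_scalars <;> ring_nf <;> simp <;> try norm_num

lemma PtKP (c : ℂ) (J E : Matrix ι ι ℂ) (hE : Eᵀ = E) (hEE : E * E = 1) (hJE : J * E = E * Jᵀ) :
    (Pm E)ᵀ * Km c J E * Pm E = fromBlocks 0 (-(c • 1 + Jᵀ)) (c • 1 + J) 0 := by
  have hJE' : Jᵀ * E = E * J := by
    calc _ = E * (E * Jᵀ) * E := by rw [← mul_assoc E E, hEE, one_mul]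
      _ = E * J * (E * E) := by rw [← hJE]; simp only [mul_assoc]
      _ = _ := by rw [hEE, mul_one]
  have hEE' : ∀ Z, E * (E * Z) = Z := fun Z => by rw [← mul_assoc, hEE, one_mul]
  simp only [Pm, Km, fromBlocks_transpose, fromBlocks_multiply, fromBlocks_inj, transpose_smul,
    transpose_one, hE, smul_mul_assoc, mul_smul_comm, mul_one, one_mul, smul_smul, add_mul, mul_add,
    sub_mul, mul_sub, neg_mul, mul_neg, mul_assoc, hJE, hJE', hEE, hEE', smul_add, smul_sub, smul_neg]
  refine ⟨?_, ?_, ?_, ?_⟩ <;> match_scalars <;> ring_nf <;> simp <;> try norm_num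

end Aux

section Main

variable {N : ℕ} (α m : Fin N → ℕ)

abbrev Idx := (r : Fin N) × (Fin (α r) × Fin (m r))

def Jm : Matrix (Idx α m) (Idx α m) ℂ := Matrix.of fun a b =>
  if a.1 = b.1 ∧ (b.2.1 : ℕ) = a.2.1 + 1 ∧ (a.2.2 : ℕ) = b.2.2 then 1 else 0

def flipE : Idx α m ≃ Idx α m := Equiv.sigmaCongrRight fun _ => Equiv.prodCongr Fin.revPerm (Equiv.refl _)

def Em : Matrix (Idx α m) (Idx α m) ℂ := (1 : Matrix (Idx α m) (Idx α m) ℂ).submatrix (flipE α m) id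

def eIdx : ((r : Fin N) × (_j : Fin (m r)) × (Fin (α r) ⊕ Fin (α r))) ≃ (Idx α m ⊕ Idx α m) where
  toFun x := match x with
    | ⟨r, j, Sum.inl i⟩ => Sum.inl ⟨r, i, j⟩
    | ⟨r, j, Sum.inr i⟩ => Sum.inr ⟨r, i, j⟩
  invFun x := match x with
    | Sum.inl ⟨r, i, j⟩ => ⟨r, j, Sum.inl i⟩
    | Sum.inr ⟨r, i, j⟩ => ⟨r, j, Sum.inr i⟩
  left_inv := by rintro ⟨r, j, i | i⟩ <;> rfl
  right_inv := by rintro (⟨r, i, j⟩ | ⟨r, i, j⟩) <;> rfl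

lemma flipE_flipE (a : Idx α m) : flipE α m (flipE α m a) = a := by
  obtain ⟨r, i, p⟩ := a
  simp [flipE]

lemma Em_mul (A : Matrix (Idx α m) (Idx α m) ℂ) : Em α m * A = A.submatrix (flipE α m) id := by
  ext a b
  simp [Em, Matrix.mul_apply, Matrix.one_apply]

lemma Em_mul_self : Em α m * Em α m = 1 := by
  rw [Em_mul]
  ext a b
  change (1 : Matrix (Idx α m) (Idx α m) ℂ) (flipE α m (flipE α m a)) b = _
  rw [flipE_flipE]

lemma Em_transpose : (Em α m)ᵀ = Em α m := by
  ext a b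
  simp only [Em, transpose_apply, submatrix_apply, id, Matrix.one_apply]
  congr 1
  apply propext
  constructor
  · rintro rfl; exact flipE_flipE α m _
  · rintro rfl; exact flipE_flipE α m _

lemma Idx_ext {a b : Idx α m} (h : a.1 = b.1) (h1 : (a.2.1 : ℕ) = b.2.1)
    (h2 : (a.2.2 : ℕ) = b.2.2) : a = b := by
  obtain ⟨r, i, p⟩ := a
  obtain ⟨s, j, q⟩ := b
  dsimp at h
  subst h
  simp only [Sigma.mk.injEq, heq_eq_eq, Prod.mk.injEq, true_and]
  exact ⟨Fin.ext h1, Fin.ext h2⟩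

lemma Jm_flip (a b : Idx α m) : Jm α m (flipE α m a) b = Jm α m (flipE α m b) a := by
  obtain ⟨r, i, p⟩ := a
  obtain ⟨s, j, q⟩ := b
  simp only [Jm, flipE, Matrix.of_apply, Equiv.sigmaCongrRight_apply, Sigma.map, Equiv.prodCongr_apply,
    Prod.map, Fin.revPerm_apply, Equiv.refl_apply, Fin.val_rev]
  congr 1
  apply propext
  by_cases h : r = s
  · subst h
    simp only [true_and]
    omega
  · simp [h, Ne.symm h]

lemma Jm_Em : Jm α m * Em α m = Em α m * (Jm α m)ᵀ := by
  have : Jm α m * Em α m = (Em α m * (Jm α m)ᵀ) := by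
    have h : Em α m * Jm α m = (Em α m * Jm α m)ᵀ := by
      rw [Em_mul]
      ext a b
      exact Jm_flip α m a b
    rw [transpose_mul, Em_transpose] at h
    have h2 := congrArg transpose h
    calc _ = Em α m * (Em α m * Jm α m) * Em α m := by
          rw [← mul_assoc, Em_mul_self, one_mul]
      _ = Em α m * (Jm α m)ᵀ * (Em α m * Em α m) := by rw [h]; simp only [mul_assoc]
      _ = _ := by rw [Em_mul_self, mul_one]
  exact this

lemma Jm_pow (k : ℕ) (a b : Idx α m) (h : (Jm α m ^ k) a b ≠ 0) : (b.2.1 : ℕ) = a.2.1 + k := by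
  induction k generalizing b with
  | zero =>
    rw [pow_zero] at h
    by_contra hne
    exact h (Matrix.one_apply_ne (by rintro rfl; simp at hne))
  | succ k ih =>
    rw [pow_succ, Matrix.mul_apply] at h
    obtain ⟨d, -, hd⟩ := Finset.exists_ne_zero_of_sum_ne_zero h
    have h1 := ih d (left_ne_zero_of_mul hd)
    have h2 := right_ne_zero_of_mul hd
    simp only [Jm, Matrix.of_apply, ne_eq, ite_eq_right_iff, not_forall] at h2
    obtain ⟨⟨_, h3, _⟩, _⟩ := h2
    omega

lemma Jm_nil : IsNilpotent (Jm α m) := by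
  refine ⟨∑ r, α r, ?_⟩
  ext a b
  by_contra h
  have h1 := Jm_pow α m _ a b h
  have h2 := b.2.1.isLt
  have h3 : α b.1 ≤ ∑ r, α r := Finset.single_le_sum (fun _ _ => Nat.zero_le _) (Finset.mem_univ _)
  omega

lemma mul_Jm_succ (X : Matrix (Idx α m) (Idx α m) ℂ) (a : Idx α m) (s : Fin N)
    (j j' : Fin (α s)) (q : Fin (m s)) (h : (j' : ℕ) = j + 1) :
    (X * Jm α m) a ⟨s, j', q⟩ = X a ⟨s, j, q⟩ := by
  rw [Matrix.mul_apply, Finset.sum_eq_single (⟨s, j, q⟩ : Idx α m)]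
  · simp [Jm, h]
  · intro b _ hb
    rw [Jm, Matrix.of_apply, if_neg, mul_zero]
    rintro ⟨h1, h2, h3⟩
    exact hb (Idx_ext α m h1 (by dsimp at h2 ⊢; omega) h3)
  · simp

lemma mul_Jm_zero (X : Matrix (Idx α m) (Idx α m) ℂ) (a : Idx α m) (s : Fin N)
    (j' : Fin (α s)) (q : Fin (m s)) (h : (j' : ℕ) = 0) :
    (X * Jm α m) a ⟨s, j', q⟩ = 0 := by
  rw [Matrix.mul_apply]
  apply Finset.sum_eq_zero
  intro b _
  rw [Jm, Matrix.of_apply, if_neg, mul_zero]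
  rintro ⟨h1, h2, h3⟩
  dsimp at h2
  omega

lemma Jm_mul_succ (X : Matrix (Idx α m) (Idx α m) ℂ) (b : Idx α m) (r : Fin N)
    (i i' : Fin (α r)) (p : Fin (m r)) (h : (i' : ℕ) = i + 1) :
    (Jm α m * X) ⟨r, i, p⟩ b = X ⟨r, i', p⟩ b := by
  rw [Matrix.mul_apply, Finset.sum_eq_single (⟨r, i', p⟩ : Idx α m)]
  · simp [Jm, h]
  · intro b _ hb
    rw [Jm, Matrix.of_apply, if_neg, zero_mul]
    rintro ⟨h1, h2, h3⟩
    exact hb (Idx_ext α m h1.symm (by dsimp at h2 ⊢; omega) h3.symm)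
  · simp

lemma Jm_mul_last (X : Matrix (Idx α m) (Idx α m) ℂ) (b : Idx α m) (r : Fin N)
    (i : Fin (α r)) (p : Fin (m r)) (h : (i : ℕ) + 1 = α r) :
    (Jm α m * X) ⟨r, i, p⟩ b = 0 := by
  rw [Matrix.mul_apply]
  apply Finset.sum_eq_zero
  rintro ⟨s, j, q⟩ _
  rw [Jm, Matrix.of_apply, if_neg, zero_mul]
  rintro ⟨h1, h2, h3⟩
  dsimp at h1 h2
  subst h1
  have := j.isLt
  omega

lemma toeplitz_iff (X : Matrix (Idx α m) (Idx α m) ℂ) :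
    X * Jm α m = Jm α m * X ↔ BlockToeplitz N α m X := by
  constructor
  · intro h
    have h' := fun a b => congrFun (congrFun h a) b
    refine ⟨?_, ?_, ?_⟩
    · intro r s i i' j j' p q hi hj
      have := h' ⟨r, i, p⟩ ⟨s, j', q⟩
      rw [mul_Jm_succ α m X _ s j j' q hj, Jm_mul_succ α m X _ r i i' p hi] at this
      exact this.symm
    · intro r s i j p q hi hj
      have hlt := i.isLt
      have := h' ⟨r, ⟨i - 1, by omega⟩, p⟩ ⟨s, j, q⟩
      rw [mul_Jm_zero α m X _ s j q hj, Jm_mul_succ α m X _ r _ i p (by dsimp; omega)] at this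
      exact this.symm
    · intro r s i j p q hi hj
      have := h' ⟨r, i, p⟩ ⟨s, ⟨j + 1, hj⟩, q⟩
      rw [mul_Jm_succ α m X _ s j _ q rfl, Jm_mul_last α m X _ r i p hi] at this
      exact this
  · rintro ⟨h1, h2, h3⟩
    ext ⟨r, i, p⟩ ⟨s, j, q⟩
    have hi := i.isLt
    have hj := j.isLt
    by_cases hj0 : (j : ℕ) = 0
    · rw [mul_Jm_zero α m X _ s j q hj0]
      by_cases hil : (i : ℕ) + 1 = α r
      · rw [Jm_mul_last α m X _ r i p hil]
      · rw [Jm_mul_succ α m X _ r i ⟨i + 1, by omega⟩ p rfl]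
        exact (h2 _ _ _ _ _ _ (by simp) hj0).symm
    · rw [mul_Jm_succ α m X _ s ⟨j - 1, by omega⟩ j q (by dsimp; omega)]
      by_cases hil : (i : ℕ) + 1 = α r
      · rw [Jm_mul_last α m X _ r i p hil]
        exact h3 _ _ _ _ _ _ hil (by dsimp; omega)
      · rw [Jm_mul_succ α m X _ r i ⟨i + 1, by omega⟩ p rfl]
        exact (h1 _ _ _ _ _ _ _ _ rfl (by dsimp; omega)).symm

lemma KK_reindex (lam : ℂ) :
    Matrix.reindex (eIdx α m) (eIdx α m) (KK N α m lam) = Km lam (Jm α m) (Em α m) := by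
  have key : ∀ (r s : Fin N) (p : Fin (m r)) (q : Fin (m s)) (x : Fin (α r) ⊕ Fin (α r))
      (y : Fin (α s) ⊕ Fin (α s)), KK N α m lam ⟨r, p, x⟩ ⟨s, q, y⟩ =
      if h : r = s then (if (p : ℕ) = q then Kmat (α s) lam (h ▸ x) y else 0) else 0 := by
    intro r s p q x y
    by_cases h : r = s
    · subst h
      by_cases h2 : p = q
      · subst h2
        simp [KK, Matrix.blockDiagonal'_apply]
      · have h3 : (p : ℕ) ≠ q := fun h => h2 (Fin.ext h)
        simp [KK, Matrix.blockDiagonal'_apply, h2, h3]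
    · simp [KK, Matrix.blockDiagonal'_apply, h]
  have hM : ∀ (r s : Fin N) (p : Fin (m r)) (q : Fin (m s)) (i : Fin (α r)) (j : Fin (α s)),
      (if h : r = s then (if (p : ℕ) = q then Mmat (α s) (h ▸ i) j else 0) else 0) =
      ((1 / 2 : ℂ) • (Jm α m - (Jm α m)ᵀ)) ⟨r, i, p⟩ ⟨s, j, q⟩ := by
    intro r s p q i j
    by_cases h : r = s
    · subst h
      simp only [Jm, Mmat, Matrix.smul_apply, Matrix.sub_apply, transpose_apply, Matrix.of_apply,
        dite_true, true_and, smul_eq_mul]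
      split_ifs <;> first | omega | norm_num
    · simp [Jm, h, Ne.symm h]
  have hN : ∀ (r s : Fin N) (p : Fin (m r)) (q : Fin (m s)) (i : Fin (α r)) (j : Fin (α s)),
      (if h : r = s then (if (p : ℕ) = q then Nmat (α s) lam (h ▸ i) j else 0) else 0) =
      (Complex.I • (Em α m * (lam • 1 + (1 / 2 : ℂ) • (Jm α m + (Jm α m)ᵀ)))) ⟨r, i, p⟩ ⟨s, j, q⟩ := by
    intro r s p q i j
    have one_eq : ∀ a b : Idx α m, (1 : Matrix (Idx α m) (Idx α m) ℂ) a b =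
        if a.1 = b.1 ∧ (b.2.1 : ℕ) = a.2.1 ∧ (a.2.2 : ℕ) = b.2.2 then 1 else 0 := by
      intro a b
      rw [Matrix.one_apply]
      congr 1
      apply propext
      constructor
      · rintro rfl; simp
      · rintro ⟨h1, h2, h3⟩; exact Idx_ext α m h1 h2.symm h3
    rw [Em_mul]
    by_cases h : r = s
    · subst h
      have := i.isLt
      have := j.isLt
      simp only [Jm, Nmat, Matrix.smul_apply, Matrix.add_apply, transpose_apply, Matrix.of_apply,
        dite_true, true_and, smul_eq_mul, submatrix_apply, one_eq, flipE,
        Equiv.sigmaCongrRight_apply, Sigma.map, Equiv.prodCongr_apply, id,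
        Prod.map, Fin.revPerm_apply, Equiv.refl_apply, Fin.val_rev]
      split_ifs <;> first | omega | (ring_nf; done) | (simp; done)
    · simp [Jm, h, Ne.symm h, one_eq, flipE]
  ext (⟨r, i, p⟩ | ⟨r, i, p⟩) (⟨s, j, q⟩ | ⟨s, j, q⟩)
  · refine (key r s p q (Sum.inl i) (Sum.inl j)).trans ?_
    refine Eq.trans ?_ (hM r s p q i j)
    by_cases h : r = s
    · subst h; rfl
    · simp [h]
  · refine (key r s p q (Sum.inl i) (Sum.inr j)).trans ?_
    refine Eq.trans ?_ (hN r s p q i j)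
    by_cases h : r = s
    · subst h; rfl
    · simp [h]
  · refine (key r s p q (Sum.inr i) (Sum.inl j)).trans ?_
    refine Eq.trans ?_ (congrArg Neg.neg (hN r s p q i j))
    by_cases h : r = s
    · subst h
      by_cases h2 : (p : ℕ) = q <;> simp [h2, Kmat]
    · simp [h]
  · refine (key r s p q (Sum.inr i) (Sum.inr j)).trans ?_
    refine Eq.trans ?_ (congrArg Neg.neg (hM r s p q i j))
    by_cases h : r = s
    · subst h
      by_cases h2 : (p : ℕ) = q <;> simp [h2, Kmat]
    · simp [h]

end Main

/-- For `λ ≠ 0`, the isotropy group of `𝒦_λ` in the complex orthogonal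
group is conjugate (via some invertible `Ψ`, composed with a relabeling of indices, i.e. a
permutation) to `{𝒳 ⊕ (𝒳⁻¹)ᵀ : 𝒳 ∈ 𝕋^{α,μ}}`. -/
theorem stmt0 (N : ℕ) (hN : 0 < N) (α m : Fin N → ℕ)
    (hmono : ∀ r s : Fin N, r < s → α s < α r)
    (hα : ∀ r, 0 < α r) (hm : ∀ r, 0 < m r) (lam : ℂ) (hlam : lam ≠ 0) :
    ∃ (e : ((r : Fin N) × (_j : Fin (m r)) × (Fin (α r) ⊕ Fin (α r))) ≃
        (((r : Fin N) × (Fin (α r) × Fin (m r))) ⊕ ((r : Fin N) × (Fin (α r) × Fin (m r)))))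
      (Ψ : Matrix
        (((r : Fin N) × (Fin (α r) × Fin (m r))) ⊕ ((r : Fin N) × (Fin (α r) × Fin (m r))))
        (((r : Fin N) × (Fin (α r) × Fin (m r))) ⊕ ((r : Fin N) × (Fin (α r) × Fin (m r)))) ℂ),
      IsUnit Ψ ∧
      Set.BijOn (fun Q => Ψ * (Matrix.reindex e e Q) * Ψ⁻¹)
        {Q | Qᵀ * Q = 1 ∧ Qᵀ * KK N α m lam * Q = KK N α m lam}
        {Y | ∃ X : Matrix ((r : Fin N) × (Fin (α r) × Fin (m r)))
              ((r : Fin N) × (Fin (α r) × Fin (m r))) ℂ,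
            (IsUnit X ∧ BlockToeplitz N α m X) ∧ Y = Matrix.fromBlocks X 0 0 (X⁻¹)ᵀ} := by
  set P := Pm (Em α m) with hP
  have hPP := PtP (Em α m) (Em_transpose α m) (Em_mul_self α m)
  have hKP := PtKP lam (Jm α m) (Em α m) (Em_transpose α m) (Em_mul_self α m) (Jm_Em α m)
  have hFF : Fm (Idx α m) * Fm (Idx α m) = 1 := by simp [Fm, fromBlocks_multiply]
  have hΨP : (Fm (Idx α m) * Pᵀ) * P = 1 := by rw [mul_assoc, hPP, hFF]
  set Ψ := Fm (Idx α m) * Pᵀ with hΨ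
  have hPΨ : P * Ψ = 1 := mul_eq_one_comm.1 hΨP
  have hinv : Ψ⁻¹ = P := Matrix.inv_eq_right_inv hΨP
  have hcore : ∀ Q, (Qᵀ * Q = 1 ∧ Qᵀ * KK N α m lam * Q = KK N α m lam) ↔
      ∃ X : Matrix (Idx α m) (Idx α m) ℂ, (IsUnit X ∧ BlockToeplitz N α m X) ∧
        Ψ * (Matrix.reindex (eIdx α m) (eIdx α m) Q) * P = Matrix.fromBlocks X 0 0 (X⁻¹)ᵀ := by
    intro Q
    have hmul : ∀ A B : Matrix ((r : Fin N) × (_j : Fin (m r)) × (Fin (α r) ⊕ Fin (α r)))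
        ((r : Fin N) × (_j : Fin (m r)) × (Fin (α r) ⊕ Fin (α r))) ℂ, Matrix.reindex (eIdx α m) (eIdx α m) (A * B) =
        Matrix.reindex (eIdx α m) (eIdx α m) A * Matrix.reindex (eIdx α m) (eIdx α m) B := by
      intro A B
      simp [Matrix.submatrix_mul_equiv]
    have h1 : Qᵀ * Q = 1 ↔ (Matrix.reindex (eIdx α m) (eIdx α m) Q)ᵀ * 1 *
        (Matrix.reindex (eIdx α m) (eIdx α m) Q) = 1 := by
      rw [← (Matrix.reindex (eIdx α m) (eIdx α m)).injective.eq_iff, hmul, mul_one]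
      simp
    have h2 : Qᵀ * KK N α m lam * Q = KK N α m lam ↔
        (Matrix.reindex (eIdx α m) (eIdx α m) Q)ᵀ * Km lam (Jm α m) (Em α m) *
        (Matrix.reindex (eIdx α m) (eIdx α m) Q) = Km lam (Jm α m) (Em α m) := by
      rw [← (Matrix.reindex (eIdx α m) (eIdx α m)).injective.eq_iff, hmul, hmul, KK_reindex]
      simp
    rw [h1, h2, congr_iff P Ψ _ _ hPΨ, congr_iff P Ψ _ (Km lam (Jm α m) (Em α m)) hPΨ, mul_one,
      hPP, hKP, Y_iff lam hlam _ (Jm_nil α m)]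
    simp only [toeplitz_iff]
  refine ⟨eIdx α m, Ψ, IsUnit.of_mul_eq_one _ hΨP, ?_, ?_, ?_⟩
  · intro Q hQ
    simp only [hinv]
    exact (hcore Q).1 hQ
  · intro Q _ Q' _ h
    simp only [hinv] at h
    have h' := congrArg (fun Z => P * Z * Ψ) h
    have e2 : ∀ Z, P * (Ψ * Z * P) * Ψ = Z := by
      intro Z
      calc _ = (P * Ψ) * Z * (P * Ψ) := by simp only [mul_assoc]
        _ = _ := by rw [hPΨ]; simp
    simp only [e2] at h'
    exact (Matrix.reindex (eIdx α m) (eIdx α m)).injective h'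
  · rintro Y hY
    have e2 : Ψ * (P * Y * Ψ) * P = Y := by
      calc _ = (Ψ * P) * Y * (Ψ * P) := by simp only [mul_assoc]
        _ = _ := by rw [hΨP]; simp
    have e3 : Ψ * (Matrix.reindex (eIdx α m) (eIdx α m)
        ((Matrix.reindex (eIdx α m) (eIdx α m)).symm (P * Y * Ψ))) * P = Y := by
      rw [Equiv.apply_symm_apply, e2]
    refine ⟨(Matrix.reindex (eIdx α m) (eIdx α m)).symm (P * Y * Ψ), ?_, ?_⟩
    · refine (hcore _).2 ?_
      rw [e3]
      exact hY
    · simp only [hinv]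
      exact e3

end
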